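/- A propositional container A ◁ᵖ P is exponentiable in PCont if and only if it is decidable, i.e., ∀ a : A, P a ∨ ¬ P a. Here A ◁ᵖ P is exponentiable when for every propositional container B ◁ᵖ Q there exist a propositional container E ◁ᵖ V and a morphism ev : (E ◁ᵖ V) ×ᵖ (A ◁ᵖ P) → (B ◁ᵖ Q) such that for every morphism f : (C ◁ᵖ R) ×ᵖ (A ◁ᵖ P) → (B ◁ᵖ Q) there exists a unique morphism f̂ : (C ◁ᵖ R) → (E ◁ᵖ V) with ev ∘ (f̂ ×ᵖ id) = f. Moreover, when ∀ a, P a ∨ ¬ P a, the exponential of A ◁ᵖ P and B ◁ᵖ Q can be taken to have shapes A → B and positions V u = ∃ a : A, Q (u a) ∧ ¬ P a, with ev (u, a) = u a. -/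

import Mathlib

/-- A propositional container: a type of shapes with a `Prop`-valued family of positions. -/
structure PCtnr : Type 1 where
  A : Type
  P : A → Prop

/-- A morphism of propositional containers: a function on shapes whose graph reverses
the positions. -/
structure PHom (X Y : PCtnr) : Type where
  toFun : X.A → Y.A
  prop : ∀ a : X.A, Y.P (toFun a) → X.P a

/-- The identity morphism of propositional containers. -/
def PHom.id (X : PCtnr) : PHom X X :=
  ⟨fun a => a, fun _ p => p⟩

/-- Composition of morphisms of propositional containers. -/
def PHom.comp {X Y Z : PCtnr} (g : PHom Y Z) (f : PHom X Y) : PHom X Z :=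
  ⟨fun a => g.toFun (f.toFun a), fun a r => f.prop a (g.prop (f.toFun a) r)⟩

/-- The binary product of propositional containers. -/
def pprod (X Y : PCtnr) : PCtnr :=
  ⟨X.A × Y.A, fun z => X.P z.1 ∨ Y.P z.2⟩

/-- The first product projection. -/
def pfst (X Y : PCtnr) : PHom (pprod X Y) X :=
  ⟨Prod.fst, fun _ h => Or.inl h⟩

/-- The second product projection. -/
def psnd (X Y : PCtnr) : PHom (pprod X Y) Y :=
  ⟨Prod.snd, fun _ h => Or.inr h⟩

/-- Pairing of morphisms into a binary product. -/
def ppair {W X Y : PCtnr} (f : PHom W X) (g : PHom W Y) : PHom W (pprod X Y) :=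
  ⟨fun w => (f.toFun w, g.toFun w), fun w h => h.elim (f.prop w) (g.prop w)⟩

/-- The functorial action of the binary product on morphisms. -/
def pprodMap {X X' Y Y' : PCtnr} (f : PHom X X') (g : PHom Y Y') :
    PHom (pprod X Y) (pprod X' Y') :=
  ⟨Prod.map f.toFun g.toFun, fun z h => h.imp (f.prop z.1) (g.prop z.2)⟩

/-- A propositional container `X` is exponentiable when for every `Y` there is an
exponential object `E` with an evaluation morphism satisfying the universal property
of exponentials with respect to the binary products `×ᵖ`. -/
def Exponentiable (X : PCtnr) : Prop :=
  ∀ Y : PCtnr, ∃ (E : PCtnr) (ev : PHom (pprod E X) Y),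
    ∀ (C : PCtnr) (f : PHom (pprod C X) Y),
      ∃! g : PHom C E, ev.comp (pprodMap g (PHom.id X)) = f

theorem PHom.ext_toFun {X Y : PCtnr} {f g : PHom X Y} (h : f.toFun = g.toFun) : f = g := by
  cases f; cases g; cases h; rfl

/-- The container of functions into `Y`, which is the exponential when `X` is decidable. -/
def pexp (X Y : PCtnr) : PCtnr :=
  ⟨X.A → Y.A, fun u => ∃ a : X.A, Y.P (u a) ∧ ¬ X.P a⟩

/-- Evaluation by application, for a decidable exponent. -/
def pexpEval (X Y : PCtnr) (h : ∀ a, X.P a ∨ ¬ X.P a) : PHom (pprod (pexp X Y) X) Y :=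
  ⟨fun z => z.1 z.2, fun z q => (h z.2).elim Or.inr fun np => Or.inl ⟨z.2, q, np⟩⟩

/-- The transpose of a morphism out of a product. -/
def pcurry {C X Y : PCtnr} (f : PHom (pprod C X) Y) : PHom C (pexp X Y) :=
  ⟨fun c a => f.toFun (c, a), fun c ⟨a, q, np⟩ => (f.prop (c, a) q).resolve_right np⟩

theorem pexpEval_universal (X Y : PCtnr) (h : ∀ a, X.P a ∨ ¬ X.P a) (C : PCtnr)
    (f : PHom (pprod C X) Y) :
    ∃! g : PHom C (pexp X Y), (pexpEval X Y h).comp (pprodMap g (PHom.id X)) = f := by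
  refine ⟨pcurry f, rfl, ?_⟩
  rintro g rfl
  rfl

/-- The argument is constructive: `a` is decided by the position of the element of the
exponential by `⟨Prop, id⟩` that names the predicate `· = a`. -/
theorem Exponentiable.decidable {X : PCtnr} (hX : Exponentiable X) (a : X.A) :
    X.P a ∨ ¬ X.P a := by
  obtain ⟨E, ev, hev⟩ := hX ⟨Prop, fun p => p⟩
  let f : PHom (pprod ⟨Unit, fun _ => True⟩ X) ⟨Prop, fun p => p⟩ :=
    ⟨fun z => z.2 = a, fun _ _ => Or.inl trivial⟩
  obtain ⟨g, hg, hg_unique⟩ := hev _ f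
  have eval_g : ev.toFun (g.toFun (), a) = (a = a) :=
    congrFun (congrArg PHom.toFun hg) ((), a)
  rcases ev.prop (g.toFun (), a) (eval_g.mpr rfl) with hV | hP
  · refine Or.inr fun hP => ?_
    let f_false : PHom (pprod ⟨Unit, fun _ => False⟩ X) ⟨Prop, fun p => p⟩ :=
      ⟨fun z => z.2 = a, fun _ h => Or.inr (h.symm ▸ hP)⟩
    obtain ⟨k, hk, -⟩ := hev _ f_false
    have eval_k := congrArg PHom.toFun hk
    have k_eq : (⟨k.toFun, fun _ _ => trivial⟩ : PHom ⟨Unit, fun _ => True⟩ E) = g :=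
      hg_unique _ (PHom.ext_toFun eval_k)
    have names_eq : k.toFun () = g.toFun () := congrFun (congrArg PHom.toFun k_eq) ()
    exact k.prop () (names_eq.symm ▸ hV)
  · exact Or.inl hP

/-- A propositional container is exponentiable if and only if it is decidable; moreover,
for decidable `A ◁ᵖ P` the exponential with `B ◁ᵖ Q` can be taken to have shapes `A → B`,
positions `V u = ∃ a, Q (u a) ∧ ¬ P a`, and evaluation given by application. -/
theorem exponentiable_iff_decidable (A : Type) (P : A → Prop) :
    (Exponentiable ⟨A, P⟩ ↔ ∀ a : A, P a ∨ ¬ P a) ∧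
    ((∀ a : A, P a ∨ ¬ P a) → ∀ (B : Type) (Q : B → Prop),
      ∃ ev : PHom (pprod ⟨A → B, fun u => ∃ a : A, Q (u a) ∧ ¬ P a⟩ ⟨A, P⟩) ⟨B, Q⟩,
        ev.toFun = (fun z => z.1 z.2) ∧
        ∀ (C : PCtnr) (f : PHom (pprod C ⟨A, P⟩) ⟨B, Q⟩),
          ∃! g : PHom C ⟨A → B, fun u => ∃ a : A, Q (u a) ∧ ¬ P a⟩,
            ev.comp (pprodMap g (PHom.id ⟨A, P⟩)) = f) :=
  ⟨⟨Exponentiable.decidable, fun h Y => ⟨pexp ⟨A, P⟩ Y, pexpEval _ Y h, pexpEval_universal _ Y h⟩⟩,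
    fun h B Q => ⟨pexpEval ⟨A, P⟩ ⟨B, Q⟩ h, rfl, pexpEval_universal ⟨A, P⟩ ⟨B, Q⟩ h⟩⟩
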